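/- arXiv:1402.2221 — 2 statements merged into one kernel-verified Lean document; each statement's English description precedes it below -/
import Mathlib

section
/- In the bid-ask special case π_{ij} = a_j/b_i (i ≠ j), π_{ii} = 1, with strict spreads 0 < b_i < a_i for all i ∈ V, the map sending a bipartition (P,N) of V to the vector y with y_i = b_i for i ∈ P and y_j = a_j for j ∈ N is a bijection between the set of all bipartitions of V and the set of all extreme directions of K_d^+ (counted up to positive scaling). In particular, K_d^+ has exactly 2^d − 2 extreme directions. -/
noncomputable section

/-- The solvency cone induced by the matrix `π`: the set of all nonnegative linear
combinations of the vectors `π i j • e^i - e^j`. -/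
def solvencyCone (d : ℕ) (π : Fin d → Fin d → ℝ) : Set (Fin d → ℝ) :=
  {x | ∃ z : Fin d → Fin d → ℝ, (∀ i j, 0 ≤ z i j) ∧
    x = ∑ i : Fin d, ∑ j : Fin d, z i j • (π i j • (Pi.single i 1 : Fin d → ℝ) - (Pi.single j 1 : Fin d → ℝ))}

/-- The (positive) dual cone of a set `K ⊆ ℝ^d`. -/
def dualCone (d : ℕ) (K : Set (Fin d → ℝ)) : Set (Fin d → ℝ) :=
  {y | ∀ x ∈ K, 0 ≤ ∑ l : Fin d, x l * y l}

/-- The bid-ask market price matrix: `π i i = 1` and `π i j = a j / b i` for `i ≠ j`. -/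
def bidAsk (d : ℕ) (a b : Fin d → ℝ) : Fin d → Fin d → ℝ :=
  fun i j => if i = j then 1 else a j / b i

/-- `y` is an extreme direction of the cone `K`: it is a nonzero element of `K`
which cannot be written as the sum of two directions of `K` that are not positive
multiples of `y`. -/
def IsExtremeDir (d : ℕ) (K : Set (Fin d → ℝ)) (y : Fin d → ℝ) : Prop :=
  y ∈ K ∧ y ≠ 0 ∧ ∀ u v : Fin d → ℝ, u ∈ K → v ∈ K → u ≠ 0 → v ≠ 0 → y = u + v →
    (∃ α : ℝ, 0 < α ∧ u = α • y) ∨ (∃ α : ℝ, 0 < α ∧ v = α • y)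

/-- The vector associated to a bipartition `(Q, Qᶜ)`: components `b i` on `Q`
and `a j` on the complement. -/
def bipVec (d : ℕ) (a b : Fin d → ℝ) (Q : Finset (Fin d)) : Fin d → ℝ :=
  fun i => if i ∈ Q then b i else a i

lemma mem_dualCone_solvencyCone_iff {d : ℕ} {π : Fin d → Fin d → ℝ} {y : Fin d → ℝ} :
    y ∈ dualCone d (solvencyCone d π) ↔ ∀ i j, y j ≤ π i j * y i := by
  have key (z : Fin d → Fin d → ℝ) :
      ∑ l, (∑ i : Fin d, ∑ j : Fin d, z i j • (π i j • (Pi.single i 1 : Fin d → ℝ) -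
        (Pi.single j 1 : Fin d → ℝ))) l * y l = ∑ i, ∑ j, z i j * (π i j * y i - y j) := by
    change (∑ i : Fin d, ∑ j : Fin d, z i j • (π i j • (Pi.single i 1 : Fin d → ℝ) -
        (Pi.single j 1 : Fin d → ℝ))) ⬝ᵥ y = _
    simp only [sum_dotProduct, smul_dotProduct, sub_dotProduct, single_one_dotProduct, smul_eq_mul]
  constructor
  · intro h i j
    have hij := h _ ⟨fun k l => if k = i ∧ l = j then 1 else 0,
      fun k l => by dsimp only; split_ifs <;> norm_num, rfl⟩
    rw [key] at hij
    simpa [ite_and] using hij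
  · rintro h x ⟨z, hz, rfl⟩
    rw [key]
    exact Finset.sum_nonneg fun i _ => Finset.sum_nonneg fun j _ =>
      mul_nonneg (hz i j) (sub_nonneg.2 (h i j))

lemma mem_dualCone_bidAsk_iff {d : ℕ} {a b y : Fin d → ℝ} (hb : ∀ i, 0 < b i) :
    y ∈ dualCone d (solvencyCone d (bidAsk d a b)) ↔ ∀ i j, i ≠ j → b i * y j ≤ a j * y i := by
  rw [mem_dualCone_solvencyCone_iff]
  refine forall₂_congr fun i j => ?_
  by_cases hij : i = j
  · simp [bidAsk, hij]
  · simp only [bidAsk, hij, if_false, ne_eq, not_false_eq_true, true_imp_iff]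
    rw [div_mul_eq_mul_div, le_div_iff₀ (hb i), mul_comm (y j)]

/-- The dual cone of the bid-ask cone contains every nonnegative multiple of the box `[b, a]`. -/
lemma mem_dualCone_bidAsk_of_mem_box {d : ℕ} {a b y : Fin d → ℝ} (hb : ∀ i, 0 < b i)
    (hba : ∀ i, b i < a i) {r : ℝ} (hl : ∀ i, r * b i ≤ y i) (hu : ∀ i, y i ≤ r * a i) :
    y ∈ dualCone d (solvencyCone d (bidAsk d a b)) := by
  rw [mem_dualCone_bidAsk_iff hb]
  intro i j _
  calc b i * y j ≤ b i * (r * a j) := mul_le_mul_of_nonneg_left (hu j) (hb i).le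
    _ = a j * (r * b i) := by ring
    _ ≤ a j * y i := mul_le_mul_of_nonneg_left (hl i) ((hb j).trans (hba j)).le

lemma pos_of_mem_dualCone_bidAsk {d : ℕ} (hd : 2 ≤ d) {a b y : Fin d → ℝ} (hb : ∀ i, 0 < b i)
    (hba : ∀ i, b i < a i) (hy : y ∈ dualCone d (solvencyCone d (bidAsk d a b))) (hy0 : y ≠ 0)
    (i : Fin d) : 0 < y i := by
  have : Nontrivial (Fin d) := Fin.nontrivial_iff_two_le.2 hd
  rw [mem_dualCone_bidAsk_iff hb] at hy
  have nonneg (i : Fin d) : 0 ≤ y i := by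
    obtain ⟨j, hj⟩ := exists_ne i
    have h₁ := mul_le_mul_of_nonneg_left (hy i j hj.symm) ((hb i).trans (hba i)).le
    have h₂ := mul_le_mul_of_nonneg_left (hy j i hj) (hb i).le
    have h₃ : b i * b j < a i * a j := mul_lt_mul'' (hba i) (hba j) (hb i).le (hb j).le
    have h₄ : 0 ≤ (a i * a j - b i * b j) * y i := by linarith
    exact nonneg_of_mul_nonneg_right h₄ (sub_pos.2 h₃)
  refine (nonneg i).lt_of_ne' fun hi => hy0 (funext fun j => ?_)
  by_cases hij : i = j
  · exact hij ▸ hi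
  · have h := hy i j hij
    rw [hi, mul_zero] at h
    exact le_antisymm (nonpos_of_mul_nonpos_right h (hb i)) (nonneg j)

lemma bipVec_of_mem {d : ℕ} {a b : Fin d → ℝ} {Q : Finset (Fin d)} {i : Fin d} (h : i ∈ Q) :
    bipVec d a b Q i = b i := if_pos h

lemma bipVec_of_notMem {d : ℕ} {a b : Fin d → ℝ} {Q : Finset (Fin d)} {i : Fin d} (h : i ∉ Q) :
    bipVec d a b Q i = a i := if_neg h

lemma le_bipVec {d : ℕ} {a b : Fin d → ℝ} (hba : ∀ i, b i < a i) (Q : Finset (Fin d))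
    (i : Fin d) : b i ≤ bipVec d a b Q i := by
  unfold bipVec
  split_ifs
  exacts [le_rfl, (hba i).le]

lemma bipVec_le {d : ℕ} {a b : Fin d → ℝ} (hba : ∀ i, b i < a i) (Q : Finset (Fin d))
    (i : Fin d) : bipVec d a b Q i ≤ a i := by
  unfold bipVec
  split_ifs
  exacts [(hba i).le, le_rfl]

lemma isExtremeDir_bipVec {d : ℕ} (hd : 2 ≤ d) {a b : Fin d → ℝ} (hb : ∀ i, 0 < b i)
    (hba : ∀ i, b i < a i) {Q : Finset (Fin d)} (hQ : Q.Nonempty) (hQ' : Q ≠ Finset.univ) :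
    IsExtremeDir d (dualCone d (solvencyCone d (bidAsk d a b))) (bipVec d a b Q) := by
  obtain ⟨p, hp⟩ := hQ
  obtain ⟨n, hn⟩ : ∃ n, n ∉ Q := by simpa [Finset.eq_univ_iff_forall] using hQ'
  refine ⟨mem_dualCone_bidAsk_of_mem_box (r := 1) hb hba (by simpa using le_bipVec hba Q)
    (by simpa using bipVec_le hba Q), fun h => ?_, fun u v hu hv hu0 _ huv => Or.inl ?_⟩
  · exact (hb p).ne' (by simpa [bipVec, hp] using congrFun h p)
  have up := pos_of_mem_dualCone_bidAsk hd hb hba hu hu0 p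
  rw [mem_dualCone_bidAsk_iff hb] at hu hv
  have tight {i j : Fin d} (hi : i ∈ Q) (hj : j ∉ Q) : b i * u j = a j * u i := by
    have hij : i ≠ j := fun h => hj (h ▸ hi)
    have hsi : b i = u i + v i := (bipVec_of_mem hi).symm.trans (congrFun huv i)
    have hsj : a j = u j + v j := (bipVec_of_notMem hj).symm.trans (congrFun huv j)
    refine le_antisymm (hu i j hij) ?_
    have hvij := hv i j hij
    rw [eq_sub_of_add_eq' hsi.symm, eq_sub_of_add_eq' hsj.symm] at hvij
    linarith
  have outside {j : Fin d} (hj : j ∉ Q) : u j = u p / b p * a j := by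
    have := tight hp hj
    have := (hb p).ne'
    field_simp
    linarith
  refine ⟨u p / b p, div_pos up (hb p), funext fun i => ?_⟩
  rw [Pi.smul_apply, smul_eq_mul]
  by_cases hi : i ∈ Q
  · rw [bipVec_of_mem hi]
    have h := tight hi hn
    rw [outside hn] at h
    exact mul_left_cancel₀ ((hb n).trans (hba n)).ne' (by linarith)
  · rw [bipVec_of_notMem hi, outside hi]

lemma eq_of_bipVec_eq_smul {d : ℕ} {a b : Fin d → ℝ} (hb : ∀ i, 0 < b i) (hba : ∀ i, b i < a i)
    {Q Q' : Finset (Fin d)} (hQ : Q.Nonempty) (hQ' : Q'.Nonempty) {α : ℝ}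
    (h : bipVec d a b Q = α • bipVec d a b Q') : Q = Q' := by
  have h (i : Fin d) : bipVec d a b Q i = α * bipVec d a b Q' i := congrFun h i
  have one_le : 1 ≤ α := by
    obtain ⟨j, hj⟩ := hQ'
    have hj' := h j
    rw [bipVec_of_mem hj] at hj'
    exact le_of_mul_le_mul_right (by linarith [le_bipVec hba Q j]) (hb j)
  have le_one : α ≤ 1 := by
    obtain ⟨j, hj⟩ := hQ
    have hj' := h j
    rw [bipVec_of_mem hj] at hj'
    have := mul_le_mul_of_nonneg_left (le_bipVec hba Q' j) (zero_le_one.trans one_le)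
    exact le_of_mul_le_mul_right (by linarith) (hb j)
  obtain rfl := le_antisymm le_one one_le
  ext i
  have hi := h i
  have := hba i
  by_cases h₁ : i ∈ Q <;> by_cases h₂ : i ∈ Q' <;> simp only [bipVec, h₁, h₂] at hi ⊢ <;>
    norm_num at hi <;> linarith

/-- An extreme direction lying in the multiple `r • [b, a]` of the box is one of its vertices. -/
lemma IsExtremeDir.eq_or_eq_of_mem_box {d : ℕ} (hd : 2 ≤ d) {a b y : Fin d → ℝ}
    (hb : ∀ i, 0 < b i) (hba : ∀ i, b i < a i)
    (hy : IsExtremeDir d (dualCone d (solvencyCone d (bidAsk d a b))) y) {r : ℝ}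
    (hl : ∀ i, r * b i ≤ y i) (hu : ∀ i, y i ≤ r * a i) (k : Fin d) :
    y k = r * b k ∨ y k = r * a k := by
  have : Nontrivial (Fin d) := Fin.nontrivial_iff_two_le.2 hd
  obtain ⟨hmem, hy0, hext⟩ := hy
  by_contra! hk
  obtain ⟨j, hj⟩ := exists_ne k
  have yj := pos_of_mem_dualCone_bidAsk hd hb hba hmem hy0 j
  have hlk := (hl k).lt_of_ne' hk.1
  have huk := (hu k).lt_of_ne hk.2
  set ε := min (y k - r * b k) (r * a k - y k)
  have ε_pos : 0 < ε := lt_min (sub_pos.2 hlk) (sub_pos.2 huk)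
  have ε_le₁ : ε ≤ y k - r * b k := min_le_left _ _
  have ε_le₂ : ε ≤ r * a k - y k := min_le_right _ _
  let w (δ : ℝ) : Fin d → ℝ := fun i => (y i + if i = k then δ else 0) / 2
  have w_mem (δ : ℝ) (hδ : |δ| ≤ ε) : w δ ∈ dualCone d (solvencyCone d (bidAsk d a b)) := by
    obtain ⟨h₁, h₂⟩ := abs_le.1 hδ
    refine mem_dualCone_bidAsk_of_mem_box (r := r / 2) hb hba (fun i => ?_) (fun i => ?_) <;>
    · have := hl i
      have := hu i
      by_cases hi : i = k
      · subst hi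
        simp only [w, if_true]
        linarith
      · simp only [w, hi, if_false]
        linarith
  have w_j (δ : ℝ) : w δ j = y j / 2 := by simp [w, hj]
  have w_k (δ : ℝ) : w δ k = (y k + δ) / 2 := by simp [w]
  have w_ne (δ : ℝ) : w δ ≠ 0 := fun h => by
    have := congrFun h j
    rw [w_j, Pi.zero_apply] at this
    linarith
  have w_not_smul (δ : ℝ) (hδ : δ ≠ 0) (α : ℝ) (h : w δ = α • y) : False := by
    have h₁ := congrFun h j
    have h₂ := congrFun h k
    rw [w_j, Pi.smul_apply, smul_eq_mul] at h₁
    rw [w_k, Pi.smul_apply, smul_eq_mul] at h₂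
    have hα : α = 1 / 2 := mul_right_cancel₀ yj.ne' (by linarith)
    rw [hα] at h₂
    exact hδ (by linarith)
  have hsum : y = w ε + w (-ε) := by
    funext i
    simp only [w, Pi.add_apply]
    split_ifs <;> ring
  rcases hext (w ε) (w (-ε)) (w_mem _ (abs_of_pos ε_pos).le)
    (w_mem _ (by rw [abs_neg, abs_of_pos ε_pos])) (w_ne _) (w_ne _) hsum with ⟨α, -, h⟩ | ⟨α, -, h⟩
  · exact w_not_smul ε ε_pos.ne' α h
  · exact w_not_smul (-ε) (neg_ne_zero.2 ε_pos.ne') α h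

lemma IsExtremeDir.exists_eq_smul_bipVec {d : ℕ} (hd : 2 ≤ d) {a b y : Fin d → ℝ}
    (hb : ∀ i, 0 < b i) (hba : ∀ i, b i < a i)
    (hy : IsExtremeDir d (dualCone d (solvencyCone d (bidAsk d a b))) y) :
    ∃ Q : Finset (Fin d), Q.Nonempty ∧ Q ≠ Finset.univ ∧
      ∃ α : ℝ, 0 < α ∧ y = α • bipVec d a b Q := by
  have : Nontrivial (Fin d) := Fin.nontrivial_iff_two_le.2 hd
  have ha (i : Fin d) : 0 < a i := (hb i).trans (hba i)
  have ypos := pos_of_mem_dualCone_bidAsk hd hb hba hy.1 hy.2.1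
  obtain ⟨n, hn⟩ := Finite.exists_max fun i => y i / a i
  obtain ⟨p, hp⟩ := Finite.exists_min fun i => y i / b i
  have hnp : y n / a n ≤ y p / b p := by
    by_cases h : p = n
    · exact h ▸ div_le_div_of_nonneg_left (ypos p).le (hb p) (hba p).le
    · rw [div_le_div_iff₀ (ha n) (hb p)]
      linarith [(mem_dualCone_bidAsk_iff hb).1 hy.1 p n h]
  have lower {r : ℝ} (hr : r ≤ y p / b p) (i : Fin d) : r * b i ≤ y i :=
    (le_div_iff₀ (hb i)).1 (hr.trans (hp i))
  have upper {r : ℝ} (hr : y n / a n ≤ r) (i : Fin d) : y i ≤ r * a i :=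
    (div_le_iff₀ (ha i)).1 ((hn i).trans hr)
  have heq : y n / a n = y p / b p := by
    by_contra hne
    obtain ⟨r, hnr, hrp⟩ := exists_between (hnp.lt_of_ne hne)
    rcases hy.eq_or_eq_of_mem_box hd hb hba (lower hrp.le) (upper hnr.le) p with h | h
    · exact hrp.ne (by rw [h, mul_div_cancel_right₀ _ (hb p).ne'])
    · exact (((div_le_iff₀ (ha p)).1 (hn p)).trans_lt (mul_lt_mul_of_pos_right hnr (ha p))).ne h
  have vertex := hy.eq_or_eq_of_mem_box hd hb hba (lower hnp) (upper le_rfl)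
  have r_pos : 0 < y n / a n := div_pos (ypos n) (ha n)
  refine ⟨Finset.univ.filter fun i => y i = y n / a n * b i, ⟨p, ?_⟩, fun h => ?_,
    y n / a n, r_pos, funext fun i => ?_⟩
  · simp only [Finset.mem_filter, Finset.mem_univ, true_and]
    rw [heq, div_mul_cancel₀ _ (hb p).ne']
  · have hn' : y n = y n / a n * b n := by simpa using Finset.eq_univ_iff_forall.1 h n
    have := mul_lt_mul_of_pos_left (hba n) r_pos
    rw [← hn', div_mul_cancel₀ _ (ha n).ne'] at this
    exact this.false
  · simp only [Pi.smul_apply, smul_eq_mul, bipVec, Finset.mem_filter, Finset.mem_univ, true_and]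
    split_ifs with hi
    · exact hi
    · exact (vertex i).resolve_left hi

/-- Corollary 14: in the bid-ask case with strict spreads `0 < b i < a i`, the map
`(P,N) ↦ (b on P, a on N)` is a bijection between bipartitions of `V` and extreme
directions of `K_d^+` up to positive scaling; in particular `K_d^+` has exactly
`2^d - 2` extreme directions. -/
theorem bidAsk_strict_extremeDirs_bijection (d : ℕ) (hd : 2 ≤ d) (a b : Fin d → ℝ)
    (hb : ∀ i, 0 < b i) (hba : ∀ i, b i < a i) :
    (∀ Q : Finset (Fin d), Q.Nonempty → Q ≠ Finset.univ →
      IsExtremeDir d (dualCone d (solvencyCone d (bidAsk d a b))) (bipVec d a b Q)) ∧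
    (∀ Q Q' : Finset (Fin d), Q.Nonempty → Q ≠ Finset.univ →
      Q'.Nonempty → Q' ≠ Finset.univ →
      (∃ α : ℝ, 0 < α ∧ bipVec d a b Q = α • bipVec d a b Q') → Q = Q') ∧
    (∀ y : Fin d → ℝ, IsExtremeDir d (dualCone d (solvencyCone d (bidAsk d a b))) y →
      ∃ Q : Finset (Fin d), Q.Nonempty ∧ Q ≠ Finset.univ ∧
        ∃ α : ℝ, 0 < α ∧ y = α • bipVec d a b Q) ∧
    (∃ Y : Finset (Fin d → ℝ), Y.card = 2 ^ d - 2 ∧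
      (∀ z ∈ Y, IsExtremeDir d (dualCone d (solvencyCone d (bidAsk d a b))) z) ∧
      (∀ z ∈ Y, ∀ w ∈ Y, (∃ α : ℝ, 0 < α ∧ z = α • w) → z = w) ∧
      (∀ y : Fin d → ℝ, IsExtremeDir d (dualCone d (solvencyCone d (bidAsk d a b))) y →
        ∃ z ∈ Y, ∃ α : ℝ, 0 < α ∧ y = α • z)) := by
  have extreme (Q : Finset (Fin d)) (hQ : Q.Nonempty) (hQ' : Q ≠ Finset.univ) :=
    isExtremeDir_bipVec hd hb hba hQ hQ'
  refine ⟨extreme, fun Q Q' hQ _ hQ' _ ⟨α, _, h⟩ => eq_of_bipVec_eq_smul hb hba hQ hQ' h,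
    fun y hy => hy.exists_eq_smul_bipVec hd hb hba,
    ((Finset.univ.erase ∅).erase Finset.univ).image (bipVec d a b), ?_, ?_, ?_, fun y hy => ?_⟩
  · have : Nonempty (Fin d) := ⟨⟨0, by lia⟩⟩
    rw [Finset.card_image_of_injOn, Finset.card_erase_of_mem, Finset.card_erase_of_mem,
      Finset.card_univ, Fintype.card_finset, Fintype.card_fin, Nat.sub_sub]
    · exact Finset.mem_univ _
    · exact Finset.mem_erase.2 ⟨Finset.univ_nonempty.ne_empty, Finset.mem_univ _⟩
    · intro Q hQ Q' hQ' h
      simp only [Finset.coe_erase, Set.mem_sdiff, Set.mem_singleton_iff, Finset.coe_univ,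
        Set.mem_univ, true_and, ← ne_eq, ← Finset.nonempty_iff_ne_empty] at hQ hQ'
      exact eq_of_bipVec_eq_smul hb hba hQ.1 hQ'.1 (α := 1) (by rw [one_smul]; exact h)
  all_goals
    simp only [Finset.mem_image, Finset.mem_erase, Finset.mem_univ, and_true,
      ← Finset.nonempty_iff_ne_empty]
  · rintro _ ⟨Q, ⟨hQ', hQ⟩, rfl⟩
    exact extreme Q hQ hQ'
  · rintro _ ⟨Q, ⟨_, hQ⟩, rfl⟩ _ ⟨Q', ⟨_, hQ'⟩, rfl⟩ ⟨α, _, h⟩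
    rw [eq_of_bipVec_eq_smul hb hba hQ hQ' h]
  · obtain ⟨Q, hQ, hQ', α, hα, h⟩ := hy.exists_eq_smul_bipVec hd hb hba
    exact ⟨_, ⟨Q, ⟨hQ', hQ⟩, rfl⟩, α, hα, h⟩
end
end

section
/- A sequence of nonnegative integers (a_1,…,a_m) is a G-draconian sequence if and only if (a_1+1,…,a_m+1) is the left degree sequence of some spanning tree of G, i.e., there is a spanning tree T of G with deg_T(i) = a_i + 1 for every left vertex i ∈ [m]. -/
noncomputable section

/-- `T` is (the edge set of) a spanning tree of the bipartite graph on `L ⊕ R`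
with edge set `H ⊆ L × R`: `T ⊆ H` and the corresponding simple graph on `L ⊕ R`
is connected and acyclic. -/
def IsSpanningTreeBip {L R : Type} (H T : Set (L × R)) : Prop :=
  T ⊆ H ∧ (SimpleGraph.fromRel (fun u v : L ⊕ R =>
    ∃ p ∈ T, u = Sum.inl p.1 ∧ v = Sum.inr p.2)).IsTree

open Finset

/-- The bipartite graph on `L ⊕ R` with edge set `T`. -/
abbrev bipGraph {L R : Type} (T : Set (L × R)) : SimpleGraph (L ⊕ R) :=
  SimpleGraph.fromRel (fun u v : L ⊕ R => ∃ p ∈ T, u = Sum.inl p.1 ∧ v = Sum.inr p.2)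

theorem bipGraph_adj_inl_inr {L R : Type} {T : Set (L × R)} {i : L} {j : R} :
    (bipGraph T).Adj (Sum.inl i) (Sum.inr j) ↔ (i, j) ∈ T := by
  simp

theorem bipGraph_edgeSet {L R : Type} (T : Set (L × R)) :
    (bipGraph T).edgeSet = (fun p : L × R => s(Sum.inl p.1, Sum.inr p.2)) '' T := by
  ext e
  induction e with
  | _ u v => rcases u with i | j <;> rcases v with i' | j' <;> simp

theorem card_edgeSet_bipGraph {L R : Type} (T : Set (L × R)) :
    Nat.card (bipGraph T).edgeSet = T.ncard := by
  rw [Nat.card_coe_set_eq, bipGraph_edgeSet]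
  refine Set.ncard_image_of_injective _ ?_
  rintro ⟨i, j⟩ ⟨i', j'⟩ h
  simpa using h

theorem SimpleGraph.IsAcyclic.card_edgeSet_add_one_le {V : Type*} [Finite V] [Nonempty V]
    {G : SimpleGraph V} (hG : G.IsAcyclic) : Nat.card G.edgeSet + 1 ≤ Nat.card V := by
  obtain ⟨F, hGF, -, hF⟩ :=
    SimpleGraph.connected_top.exists_isTree_le_of_le_of_isAcyclic (le_top (a := G)) hG
  rw [← (SimpleGraph.isTree_iff_connected_and_card.1 hF).2]
  gcongr
  exact Nat.card_mono (Set.toFinite _) (SimpleGraph.edgeSet_mono hGF)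

/-- In a forest, the edges leaving a nonempty set `s` of left vertices towards `N`
number at most `#s + #N - 1`. -/
theorem ncard_edges_add_one_le_of_isAcyclic {L R : Type}
    {T : Set (L × R)} (hT : (bipGraph T).IsAcyclic) {s : Finset L} (hs : s.Nonempty)
    {N : Finset R} (hN : ∀ p ∈ T, p.1 ∈ s → p.2 ∈ N) :
    {p ∈ T | p.1 ∈ s}.ncard + 1 ≤ #s + #N := by
  let f : s × N → L × R := Prod.map Subtype.val Subtype.val
  have hf : f.Injective := Subtype.val_injective.prodMap Subtype.val_injective
  let φ : s ⊕ N ↪ L ⊕ R := (Function.Embedding.subtype _).sumMap (Function.Embedding.subtype _)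
  have hle : bipGraph (f ⁻¹' T) ≤ (bipGraph T).comap φ := by
    rintro (i | j) (i' | j') <;> simp [f, φ]
  have hac : (bipGraph (f ⁻¹' T)).IsAcyclic := (hT.of_comap φ).anti hle
  have : Nonempty (s ⊕ N) := ⟨Sum.inl ⟨_, hs.choose_spec⟩⟩
  have hcard := hac.card_edgeSet_add_one_le
  have himage : {p ∈ T | p.1 ∈ s} = f '' (f ⁻¹' T) := by
    ext ⟨i, j⟩
    constructor
    · rintro ⟨hp, hi⟩
      exact ⟨(⟨i, hi⟩, ⟨j, hN _ hp hi⟩), hp, rfl⟩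
    · rintro ⟨⟨i', j'⟩, hp, h⟩
      rw [← h]
      exact ⟨hp, i'.2⟩
  rw [himage, Set.ncard_image_of_injective _ hf, ← card_edgeSet_bipGraph]
  simpa using hcard

theorem ncard_eq_sum_ncard_fiber {L R : Type} [Finite L] [Finite R] (T : Set (L × R))
    (s : Finset L) : {p ∈ T | p.1 ∈ s}.ncard = ∑ i ∈ s, {p ∈ T | p.1 = i}.ncard := by
  classical
  obtain ⟨F, rfl⟩ := (Set.toFinite T).exists_finset_coe
  have h1 : {p ∈ (F : Set (L × R)) | p.1 ∈ s} = ({p ∈ F | p.1 ∈ s} : Finset _) := by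
    ext; simp
  have h2 (i : L) : {p ∈ (F : Set (L × R)) | p.1 = i} = ({p ∈ F | p.1 = i} : Finset _) := by
    ext; simp
  simp_rw [h1, h2, Set.ncard_coe_finset]
  rw [card_eq_sum_card_fiberwise (f := Prod.fst) (t := s) (fun p hp => by simp_all)]
  refine sum_congr rfl fun i hi => ?_
  rw [filter_filter]
  congr 1
  ext p
  simp only [mem_filter]
  grind

/-- Every nonempty set `s` of indices satisfies `∑ i ∈ s, a i < #(⋃ i ∈ s, J i)`. -/
def IsDraconianFamily {ι κ : Type*} [DecidableEq κ] (a : ι → ℕ) (J : ι → Finset κ) : Prop :=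
  ∀ s : Finset ι, s.Nonempty → ∑ i ∈ s, a i + 1 ≤ #(s.biUnion J)

theorem IsDraconianFamily.card_biUnion_inter {ι κ : Type*} [DecidableEq ι] [DecidableEq κ]
    {a : ι → ℕ} {J : ι → Finset κ} (hJ : IsDraconianFamily a J) {s t : Finset ι}
    (hst : (s ∩ t).Nonempty) (hs : #(s.biUnion J) = ∑ i ∈ s, a i + 1)
    (ht : #(t.biUnion J) = ∑ i ∈ t, a i + 1) :
    #((s ∩ t).biUnion J) = ∑ i ∈ s ∩ t, a i + 1 := by
  have hinter := hJ _ hst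
  have hunion := hJ (s ∪ t) (hst.mono (inter_subset_left.trans subset_union_left))
  have hsum := sum_union_inter (s₁ := s) (s₂ := t) (f := a)
  have hcard := card_union_add_card_inter (s.biUnion J) (t.biUnion J)
  have hsub : (s ∩ t).biUnion J ⊆ s.biUnion J ∩ t.biUnion J :=
    subset_inter (biUnion_subset_biUnion_of_subset_left _ inter_subset_left)
      (biUnion_subset_biUnion_of_subset_left _ inter_subset_right)
  have hle := card_le_card hsub
  rw [union_biUnion] at hunion
  omega

/-- If removing `j` from `J i` is not allowed, this is witnessed by a tight set of indices
containing `i` in which `j` is covered by `J i` only. -/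
theorem exists_tight_of_minimal {ι κ : Type*} [DecidableEq ι] [DecidableEq κ]
    {a : ι → ℕ} {J : ι → Finset κ} (hJ : Minimal (IsDraconianFamily a) J) {i : ι} {j : κ}
    (hj : j ∈ J i) : ∃ s : Finset ι, i ∈ s ∧ #(s.biUnion J) = ∑ i ∈ s, a i + 1 ∧
      j ∉ (s.erase i).biUnion J := by
  have hnot : ¬ IsDraconianFamily a (Function.update J i ((J i).erase j)) := by
    intro h
    have hle : Function.update J i ((J i).erase j) ≤ J :=
      update_le_self_iff.2 (erase_subset _ _)
    have := hJ.2 h hle i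
    simp only [Function.update_self] at this
    exact notMem_erase j _ (this hj)
  simp only [IsDraconianFamily, not_forall, not_le] at hnot
  obtain ⟨s, hs, hlt⟩ := hnot
  have hdrac := hJ.1 s hs
  have hsub : s.biUnion J ⊆ insert j (s.biUnion (Function.update J i ((J i).erase j))) := by
    intro k
    simp only [mem_biUnion, mem_insert]
    rintro ⟨l, hl, hk⟩
    by_cases hkj : k = j
    · exact Or.inl hkj
    · refine Or.inr ⟨l, hl, ?_⟩
      rcases eq_or_ne l i with rfl | hli <;> simp_all
  have hnsub : ¬ s.biUnion J ⊆ s.biUnion (Function.update J i ((J i).erase j)) := by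
    intro h
    have := card_le_card h
    omega
  refine ⟨s, ?_, ?_, fun hmem => hnsub fun k hk => ?_⟩
  · by_contra hi
    refine hnsub (biUnion_congr rfl fun l hl => ?_).subset
    rw [Function.update_of_ne (ne_of_mem_of_not_mem hl hi)]
  · have := (card_le_card hsub).trans (card_insert_le _ _)
    omega
  · rcases mem_insert.1 (hsub hk) with rfl | h
    · obtain ⟨l, hl, hk'⟩ := mem_biUnion.1 hmem
      refine mem_biUnion.2 ⟨l, mem_of_mem_erase hl, ?_⟩
      rwa [Function.update_of_ne (ne_of_mem_erase hl)]
    · exact h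

theorem card_eq_of_minimal_isDraconianFamily {ι κ : Type*} [DecidableEq ι] [DecidableEq κ]
    {a : ι → ℕ} {J : ι → Finset κ} (hJ : Minimal (IsDraconianFamily a) J) (i : ι) :
    #(J i) = a i + 1 := by
  have hi : a i + 1 ≤ #(J i) := by simpa using hJ.1 {i} (singleton_nonempty i)
  have key (F : Finset κ) (hF : F.Nonempty) : F ⊆ J i → ∃ s : Finset ι, i ∈ s ∧
      #(s.biUnion J) = ∑ i ∈ s, a i + 1 ∧ Disjoint F ((s.erase i).biUnion J) := by
    induction hF using Finset.Nonempty.cons_induction with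
    | singleton j =>
      intro hj
      simpa using exists_tight_of_minimal hJ (singleton_subset_iff.1 hj)
    | cons j F hjF hF ih =>
      intro hsub
      rw [cons_subset] at hsub
      obtain ⟨s, his, hs, hjs⟩ := exists_tight_of_minimal hJ hsub.1
      obtain ⟨t, hit, ht, hFt⟩ := ih hsub.2
      have hist : i ∈ s ∩ t := mem_inter.2 ⟨his, hit⟩
      refine ⟨s ∩ t, hist, hJ.1.card_biUnion_inter ⟨i, hist⟩ hs ht, ?_⟩
      rw [cons_eq_insert, disjoint_insert_left]
      exact ⟨fun h => hjs (biUnion_subset_biUnion_of_subset_left _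
          (erase_subset_erase _ inter_subset_left) h),
        hFt.mono_right (biUnion_subset_biUnion_of_subset_left _
          (erase_subset_erase _ inter_subset_right))⟩
  obtain ⟨s, his, hs, hdisj⟩ := key (J i) (card_pos.1 (by omega)) Subset.rfl
  rw [← insert_erase his, biUnion_insert, card_union_of_disjoint hdisj,
    sum_insert (notMem_erase i s)] at hs
  rcases (s.erase i).eq_empty_or_nonempty with h | h
  · simpa [h] using hs
  · have := hJ.1 _ h
    omega

/-- A bipartite graph given by a draconian family with maximal possible total `∑ i, a i` is
connected: its vertex set cannot be split into two parts without an edge between them. -/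
theorem IsDraconianFamily.connected {L R : Type} [Fintype L] [Fintype R] [DecidableEq R]
    [Nonempty L] {a : L → ℕ} {J : L → Finset R} (hJ : IsDraconianFamily a J)
    (ha : ∑ i, a i + 1 = Fintype.card R) :
    (bipGraph {p : L × R | p.2 ∈ J p.1}).Connected := by
  classical
  set G := bipGraph {p : L × R | p.2 ∈ J p.1} with hG
  have hadj {i : L} {j : R} (hj : j ∈ J i) : G.Adj (Sum.inl i) (Sum.inr j) :=
    bipGraph_adj_inl_inr.2 hj
  have hcover (j : R) : ∃ i, j ∈ J i := by
    have huniv : univ.biUnion J = univ := by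
      rw [← card_eq_iff_eq_univ]
      exact (card_le_univ _).antisymm (ha ▸ hJ univ univ_nonempty)
    simpa using huniv.symm.subset (mem_univ j)
  let i₀ : L := Classical.arbitrary L
  let s : Finset L := {i | G.Reachable (Sum.inl i₀) (Sum.inl i)}
  have hs (i : L) : i ∈ s ↔ G.Reachable (Sum.inl i₀) (Sum.inl i) := by simp [s]
  have hsuniv : s = univ := by
    by_contra hne
    have h1 := hJ s ⟨i₀, (hs i₀).2 .rfl⟩
    have h2 := hJ sᶜ (by rwa [nonempty_iff_ne_empty, Ne, compl_eq_empty_iff])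
    have hdisj : Disjoint (s.biUnion J) (sᶜ.biUnion J) := by
      simp only [disjoint_biUnion_left, disjoint_biUnion_right]
      intro i' hi' i hi
      rw [disjoint_left]
      intro j hj hj'
      simp only [mem_compl] at hi'
      exact hi' ((hs _).2 (((hs _).1 hi).trans
        ((hadj hj).reachable.trans (hadj hj').symm.reachable)))
    have h3 := card_le_univ (s.biUnion J ∪ sᶜ.biUnion J)
    rw [card_union_of_disjoint hdisj] at h3
    have h4 := sum_add_sum_compl s a
    omega
  have hleft (i : L) : G.Reachable (Sum.inl i₀) (Sum.inl i) := (hs i).1 (hsuniv ▸ mem_univ i)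
  rw [SimpleGraph.connected_iff_exists_forall_reachable]
  refine ⟨Sum.inl i₀, ?_⟩
  rintro (i | j)
  · exact hleft i
  · obtain ⟨i, hi⟩ := hcover j
    exact (hleft i).trans (hadj hi).reachable

/-- Proposition A.2: for a bipartite graph `G ⊆ K_{m,n}` given by the sets
`I i ⊆ [n]` (no isolated vertices), a sequence `(a_1,…,a_m)` of nonnegative
integers is `G`-draconian if and only if `(a_1+1,…,a_m+1)` is the left degree
sequence of some spanning tree of `G`. -/
theorem draconian_iff_left_degree_sequence (m n : ℕ) (hm : 0 < m) (hn : 0 < n)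
    (I : Fin m → Finset (Fin n))
    (hleft : ∀ i, (I i).Nonempty) (hright : ∀ j, ∃ i, j ∈ I i)
    (a : Fin m → ℕ) :
    ((∑ i, a i = n - 1) ∧
      ∀ s : Finset (Fin m), s.Nonempty → ∑ i ∈ s, a i + 1 ≤ (s.biUnion I).card) ↔
    (∃ T : Set (Fin m × Fin n),
      IsSpanningTreeBip {p : Fin m × Fin n | p.2 ∈ I p.1} T ∧
      ∀ i : Fin m, {p ∈ T | p.1 = i}.ncard = a i + 1) := by
  constructor
  · rintro ⟨hsum, hdrac⟩
    have : Nonempty (Fin m) := ⟨⟨0, hm⟩⟩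
    obtain ⟨J, hJI, hJ⟩ := exists_minimal_le_of_wellFoundedLT (IsDraconianFamily a) I hdrac
    have hfiber (i : Fin m) :
        {p ∈ {p : Fin m × Fin n | p.2 ∈ J p.1} | p.1 = i}.ncard = a i + 1 := by
      have himage : {p ∈ {p : Fin m × Fin n | p.2 ∈ J p.1} | p.1 = i} =
          Prod.mk i '' (J i : Set (Fin n)) := by
        ext ⟨k, j⟩
        simp only [Set.mem_ofPred_eq, Set.mem_image, Prod.mk.injEq, mem_coe]
        grind
      rw [himage, Set.ncard_image_of_injective _ (Prod.mk_right_injective i),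
        Set.ncard_coe_finset, card_eq_of_minimal_isDraconianFamily hJ]
    refine ⟨{p | p.2 ∈ J p.1}, ⟨fun p hp => hJI p.1 hp, ?_⟩, hfiber⟩
    refine SimpleGraph.isTree_iff_connected_and_card.2
      ⟨hJ.1.connected (by simp only [Fintype.card_fin]; omega), ?_⟩
    have hedges := ncard_eq_sum_ncard_fiber {p : Fin m × Fin n | p.2 ∈ J p.1} univ
    simp only [mem_univ, and_true, Set.ofPred_mem_eq, hfiber, sum_add_distrib] at hedges
    rw [card_edgeSet_bipGraph, hedges]
    simp
    omega
  · rintro ⟨T, ⟨hTI, hT⟩, hdeg⟩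
    have hedges (s : Finset (Fin m)) : {p ∈ T | p.1 ∈ s}.ncard = ∑ i ∈ s, a i + #s := by
      simp [ncard_eq_sum_ncard_fiber, hdeg, sum_add_distrib]
    constructor
    · have hcard := (SimpleGraph.isTree_iff_connected_and_card.1 hT).2
      have huniv := hedges univ
      simp only [mem_univ, and_true, Set.ofPred_mem_eq, card_univ, Fintype.card_fin] at huniv
      rw [card_edgeSet_bipGraph, huniv] at hcard
      simp at hcard
      omega
    · intro s hs
      have := ncard_edges_add_one_le_of_isAcyclic hT.isAcyclic hs (N := s.biUnion I)
        fun p hp hps => mem_biUnion.2 ⟨p.1, hps, hTI hp⟩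
      rw [hedges] at this
      omega
end
end
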